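/- Let s be a sequence over a finite alphabet taking exactly a ≥ 2 distinct values, with complexity function p. If there exists k₀ ≥ 1 such that p(k) = k + a − 1 for all k ≥ k₀, then p(k) = k + a − 1 for all k ≥ 1. In particular, if a binary sequence satisfies p(k) = k + 1 for all k larger than some k₀, then it is Sturmian. -/

import Mathlib

/-- The finite word `s(i) s(i+1) ⋯ s(i+k−1)`. -/
def window {A : Type*} (s : ℕ → A) (i k : ℕ) : List A :=
  (List.range k).map fun j => s (i + j)

/-- `l` is a factor of the sequence `s`. -/
def IsFactor {A : Type*} (s : ℕ → A) (l : List A) : Prop :=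
  ∃ i, l = window s i l.length

/-- The number of distinct factors of `s` of length `k` (complexity function). -/
noncomputable def complexity {A : Type*} (s : ℕ → A) (k : ℕ) : ℕ :=
  Set.ncard {l : List A | l.length = k ∧ IsFactor s l}

/-- The shift map. -/
def shiftMap {A : Type*} (s : ℕ → A) : ℕ → A := fun n => s (n + 1)

/-- The sequence `x·u`. -/
def pre {A : Type*} (x : A) (u : ℕ → A) : ℕ → A
  | 0 => x
  | n + 1 => u n

/-- Strict lexicographic order on sequences. -/
def SeqLt {A : Type*} [LT A] (u v : ℕ → A) : Prop :=
  ∃ i, (∀ j < i, u j = v j) ∧ u i < v i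

/-- Lexicographic order on sequences. -/
def SeqLe {A : Type*} [LT A] (u v : ℕ → A) : Prop :=
  (∀ n, u n = v n) ∨ SeqLt u v

/-- Lexicographic order on (equal-length) finite words. -/
def WordLe {A : Type*} [LT A] (u v : List A) : Prop :=
  u = v ∨ List.Lex (· < ·) u v

def UltimatelyPeriodic {A : Type*} (s : ℕ → A) : Prop :=
  ∃ N, ∃ q ≥ 1, ∀ n ≥ N, s (n + q) = s n

/-- A binary sequence is Sturmian if it has complexity `k + 1` for all `k ≥ 1`. -/
def Sturmian (s : ℕ → Fin 2) : Prop :=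
  ∀ k ≥ 1, complexity s k = k + 1

/-- `w` is a left special factor of `s`. -/
def LeftSpecial {A : Type*} (s : ℕ → A) (w : List A) : Prop :=
  ∃ x y : A, x ≠ y ∧ IsFactor s (x :: w) ∧ IsFactor s (y :: w)

/-- A binary sequence is balanced. -/
def BalancedSeq (s : ℕ → Fin 2) : Prop :=
  ∀ u v : List (Fin 2), IsFactor s u → IsFactor s v → u.length = v.length →
    ((u.count 1 : ℤ) - (v.count 1 : ℤ)).natAbs ≤ 1

/-- `u` is the characteristic Sturmian sequence of slope `α`. -/
def IsCharSturmian (α : ℝ) (u : ℕ → Fin 2) : Prop :=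
  ∀ n : ℕ, ((u n : ℕ) : ℤ) = ⌊((n : ℝ) + 2) * α⌋ - ⌊((n : ℝ) + 1) * α⌋

theorem window_length' {A : Type*} (s : ℕ → A) (i k : ℕ) : (window s i k).length = k := by
  simp [window]

theorem window_eq_iff {A : Type*} (s : ℕ → A) (i j k : ℕ) :
    window s i k = window s j k ↔ ∀ m < k, s (i + m) = s (j + m) := by
  simp [window]

theorem complexity_eq {A : Type*} (s : ℕ → A) (k : ℕ) :
    complexity s k = (Set.range (fun i => window s i k)).ncard := by
  unfold complexity
  congr 1
  ext l
  constructor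
  · rintro ⟨h1, i, hi⟩
    exact ⟨i, by rw [h1] at hi; exact hi.symm⟩
  · rintro ⟨i, rfl⟩
    exact ⟨window_length' s i k, i, by simp [window_length']⟩

theorem take_window {A : Type*} (s : ℕ → A) (i k : ℕ) :
    (window s i (k + 1)).take k = window s i k := by
  simp [window, List.range_succ, List.take_left']

theorem image_take {A : Type*} (s : ℕ → A) (k : ℕ) :
    (List.take k) '' (Set.range (fun i => window s i (k + 1)))
      = Set.range (fun i => window s i k) := by
  rw [← Set.range_comp]
  congr 1
  funext i
  exact take_window s i k

theorem finite_windows {A : Type*} (s : ℕ → A) (hfin : (Set.range s).Finite) (k : ℕ) :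
    (Set.range (fun i => window s i k)).Finite := by
  have : Finite (Set.range s) := hfin
  let g : (Fin k → Set.range s) → List A := fun f => List.ofFn (fun m => (f m : A))
  refine (Set.finite_range g).subset ?_
  rintro _ ⟨i, rfl⟩
  refine ⟨fun m => ⟨s (i + m), _, rfl⟩, ?_⟩
  apply List.ext_getElem <;> simp [g, window]

theorem complexity_step {A : Type*} (s : ℕ → A) (hfin : (Set.range s).Finite) (k : ℕ) :
    complexity s k ≤ complexity s (k + 1) := by
  rw [complexity_eq, complexity_eq, ← image_take]
  exact Set.ncard_image_le (finite_windows s hfin _)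

theorem complexity_eq_step {A : Type*} (s : ℕ → A) (hfin : (Set.range s).Finite) (k : ℕ)
    (h : complexity s k = complexity s (k + 1)) :
    complexity s (k + 1) = complexity s (k + 2) := by
  rw [complexity_eq, complexity_eq, ← image_take] at h
  have hinj := Set.injOn_of_ncard_image_eq h (finite_windows s hfin _)
  have hD : ∀ i j, window s i k = window s j k → s (i + k) = s (j + k) := by
    intro i j hij
    have := hinj ⟨i, rfl⟩ ⟨j, rfl⟩ (by simpa only [take_window] using hij)
    exact (window_eq_iff s i j (k + 1)).1 this k (by omega)
  rw [complexity_eq s (k + 1), complexity_eq s (k + 2), ← image_take s (k + 1)]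
  apply Set.ncard_image_of_injOn
  rintro _ ⟨i, rfl⟩ _ ⟨j, rfl⟩ hij
  simp only [take_window] at hij
  rw [window_eq_iff] at hij
  refine (window_eq_iff s i j (k + 2)).2 fun m hm => ?_
  rcases Nat.lt_or_ge m (k + 1) with h1 | h1
  · exact hij m h1
  · obtain rfl : m = k + 1 := by omega
    have := hD (i + 1) (j + 1) ((window_eq_iff _ _ _ _).2 fun m hm => by
      have := hij (m + 1) (by omega)
      rwa [show i + 1 + m = i + (m + 1) by omega, show j + 1 + m = j + (m + 1) by omega])
    rwa [show i + (k + 1) = i + 1 + k by omega, show j + (k + 1) = j + 1 + k by omega]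

theorem complexity_strict {A : Type*} (s : ℕ → A) (hfin : (Set.range s).Finite)
    (hub : ∃ k₁, ∀ k ≥ k₁, complexity s k < complexity s (k + 1)) (k : ℕ) :
    complexity s k < complexity s (k + 1) := by
  refine lt_of_le_of_ne (complexity_step s hfin k) fun h => ?_
  have hall : ∀ n, complexity s (k + n) = complexity s (k + n + 1) := by
    intro n
    induction n with
    | zero => exact h
    | succ n ih => exact complexity_eq_step s hfin _ ih
  obtain ⟨k₁, h1⟩ := hub
  have := h1 (k + k₁) (by omega)
  have := hall k₁
  omega

theorem complexity_grow {A : Type*} (s : ℕ → A) (hfin : (Set.range s).Finite)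
    (hub : ∃ k₁, ∀ k ≥ k₁, complexity s k < complexity s (k + 1)) (k n : ℕ) :
    complexity s k + n ≤ complexity s (k + n) := by
  induction n with
  | zero => simp
  | succ n ih =>
    have := complexity_strict s hfin hub (k + n)
    rw [← add_assoc k n 1]
    omega

theorem complexity_zero {A : Type*} (s : ℕ → A) : complexity s 0 = 1 := by
  rw [complexity_eq]
  simp [window]

theorem complexity_one {A : Type*} (s : ℕ → A) : complexity s 1 = (Set.range s).ncard := by
  rw [complexity_eq, ← Set.ncard_image_of_injective (Set.range s) (f := fun x => [x])
    (fun x y h => by simpa using h), ← Set.range_comp]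
  congr 1

theorem complexity_main {A : Type*} (s : ℕ → A) (a : ℕ) (ha : 2 ≤ a)
    (hfin : (Set.range s).Finite) (hcard : (Set.range s).ncard ≤ a)
    (hcard' : a ≤ (Set.range s).ncard ∨ a = 2)
    (h : ∃ k₀, ∀ k ≥ k₀, complexity s k = k + a - 1) :
    ∀ k ≥ 1, complexity s k = k + a - 1 := by
  obtain ⟨k₀, h⟩ := h
  have hub : ∃ k₁, ∀ k ≥ k₁, complexity s k < complexity s (k + 1) := by
    refine ⟨k₀, fun k hk => ?_⟩
    rw [h k hk, h (k + 1) (by omega)]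
    omega
  intro k hk
  have h0 := complexity_strict s hfin hub 0
  rw [complexity_zero, zero_add, complexity_one] at h0
  have h1 := complexity_grow s hfin hub 1 (k - 1)
  rw [complexity_one, show 1 + (k - 1) = k by omega] at h1
  have h2 := complexity_grow s hfin hub k k₀
  rw [h (k + k₀) (by omega)] at h2
  omega

/-- If a sequence taking exactly `a ≥ 2` values satisfies `p(k) = k + a - 1` for
all `k ≥ k₀`, then this holds for all `k ≥ 1`; in particular a binary sequence
with `p(k) = k + 1` for all `k` larger than some `k₀` is Sturmian. -/
theorem stmt4 {A : Type*} (s : ℕ → A) (a : ℕ) (ha : 2 ≤ a)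
    (hfin : (Set.range s).Finite) (hcard : (Set.range s).ncard = a)
    (h : ∃ k₀ ≥ 1, ∀ k ≥ k₀, complexity s k = k + a - 1) :
    (∀ k ≥ 1, complexity s k = k + a - 1) ∧
    (∀ t : ℕ → Fin 2, (∃ k₀, ∀ k > k₀, complexity t k = k + 1) → Sturmian t) := by
  constructor
  · obtain ⟨k₀, _, h⟩ := h
    exact complexity_main s a ha hfin hcard.le (Or.inl hcard.ge) ⟨k₀, h⟩
  · rintro t ⟨k₀, ht⟩
    refine complexity_main t 2 le_rfl (Set.toFinite _) ?_ (Or.inr rfl)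
      ⟨k₀ + 1, fun k hk => ht k hk⟩
    have := Set.ncard_le_card (Set.range t)
    simpa using this
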